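/- Fix integers τ ≥ 0, k ≥ 0 and w ≥ 0, and let [M; L] be a bipartition with ‖M‖ + ‖L‖ = w + τ. Then there exist partitions λ, μ with ‖λ‖ + ‖μ‖ = w and k ≤ λ_1 such that θ_k(λ, μ) = [M; L] (the ε = + construction) if and only if τ + k occurs as a part of M, i.e., M_i = τ + k for some i ≥ 1. -/

import Mathlib

/-- The weakly decreasing rearrangement of a weakly decreasing sequence `f`
with one extra part `t` inserted. -/
def insertPart (t : ℕ) (f : ℕ → ℕ) : ℕ → ℕ
  | 0 => max (f 0) t
  | n + 1 => max (min (f n) t) (f (n + 1))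

/-- A partition: a weakly decreasing sequence of naturals with
finitely many nonzero terms. -/
def IsPartition (f : ℕ → ℕ) : Prop := Antitone f ∧ ∃ N, ∀ n, N ≤ n → f n = 0

/-- The size `‖f‖` of a partition: the sum of its parts. -/
noncomputable def psize (f : ℕ → ℕ) : ℕ := ∑ᶠ n, f n

/-- Membership of the bipartition `[M; L]` in `Θ^{+,τ}_k(λ,μ)`:
`M_i ≥ μ_i ≥ M_{i+1}`, `λ_i ≥ L_i ≥ λ_{i+1}` for all `i`, with
`‖M‖ = ‖μ‖ + τ + k` and `‖L‖ = ‖λ‖ - k`.  (All sequences are 0-indexed.) -/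
def ThetaPlusMem (τ k : ℕ) (lam mu M L : ℕ → ℕ) : Prop :=
  IsPartition M ∧ IsPartition L ∧
  (∀ i, mu i ≤ M i ∧ M (i + 1) ≤ mu i) ∧
  (∀ i, L i ≤ lam i ∧ lam (i + 1) ≤ L i) ∧
  psize M = psize mu + τ + k ∧ psize L + k = psize lam

/-- Membership of the bipartition `[M; L]` in `Θ^{-,τ}_k(λ,μ)`:
`μ_i ≥ M_i ≥ μ_{i+1}`, `L_i ≥ λ_i ≥ L_{i+1}` for all `i`, with
`‖M‖ = ‖μ‖ - k` and `‖L‖ = ‖λ‖ + τ + k`.  (All sequences are 0-indexed.) -/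
def ThetaMinusMem (τ k : ℕ) (lam mu M L : ℕ → ℕ) : Prop :=
  IsPartition M ∧ IsPartition L ∧
  (∀ i, M i ≤ mu i ∧ mu (i + 1) ≤ M i) ∧
  (∀ i, lam i ≤ L i ∧ L (i + 1) ≤ lam i) ∧
  psize M + k = psize mu ∧ psize L = psize lam + τ + k

/-- Lexicographic order on sequences: `f` strictly precedes `g`. -/
def LexLt (f g : ℕ → ℕ) : Prop := ∃ i, (∀ j, j < i → f j = g j) ∧ f i < g i

/-- The sequence `f` with its `i`-th term removed. -/
def deletePart (i : ℕ) (f : ℕ → ℕ) (n : ℕ) : ℕ := if n < i then f n else f (n + 1)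

theorem deletePart_zero (f : ℕ → ℕ) : deletePart 0 f = fun n => f (n + 1) := by
  funext n
  simp [deletePart]

theorem psize_eq_sum_range {f : ℕ → ℕ} {N : ℕ} (h : ∀ n, N ≤ n → f n = 0) :
    psize f = ∑ n ∈ Finset.range N, f n := by
  refine finsum_eq_sum_of_support_subset f fun n hn => ?_
  rw [Finset.coe_range, Set.mem_Iio]
  by_contra hlt
  exact hn (h n (not_lt.mp hlt))

theorem psize_eq_head_add_tail {f : ℕ → ℕ} (h : ∃ N, ∀ n, N ≤ n → f n = 0) :
    psize f = f 0 + psize fun n => f (n + 1) := by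
  obtain ⟨N, hN⟩ := h
  rw [psize_eq_sum_range (N := N + 1) fun n hn => hN n (by omega),
    psize_eq_sum_range (f := fun n => f (n + 1)) (N := N) fun n hn => hN (n + 1) (by omega),
    Finset.sum_range_succ', add_comm]

theorem IsPartition.deletePart {f : ℕ → ℕ} (hf : IsPartition f) (i : ℕ) :
    IsPartition (deletePart i f) := by
  obtain ⟨hanti, N, hN⟩ := hf
  refine ⟨fun a b hab => ?_, N, fun n hn => ?_⟩
  · unfold _root_.deletePart
    split_ifs <;> exact hanti (by omega)
  · unfold _root_.deletePart
    split_ifs <;> exact hN _ (by omega)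

theorem psize_deletePart_add {f : ℕ → ℕ} (h : ∃ N, ∀ n, N ≤ n → f n = 0) (i : ℕ) :
    psize (deletePart i f) + f i = psize f := by
  obtain ⟨N, hN⟩ := h
  induction i generalizing f with
  | zero =>
    rw [psize_eq_head_add_tail ⟨N, hN⟩, deletePart_zero, add_comm]
  | succ i ih =>
    have hdel : ∀ n, N ≤ n → deletePart (i + 1) f n = 0 := fun n hn => by
      unfold deletePart
      split_ifs <;> exact hN _ (by omega)
    have htail : (fun n => deletePart (i + 1) f (n + 1)) = deletePart i fun n => f (n + 1) := by
      funext n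
      simp [deletePart]
    have hhead : deletePart (i + 1) f 0 = f 0 := by simp [deletePart]
    rw [psize_eq_head_add_tail ⟨N, hN⟩, psize_eq_head_add_tail ⟨N, hdel⟩, htail, hhead,
      ← ih (f := fun n => f (n + 1)) fun n hn => hN (n + 1) (by omega), add_assoc]

theorem insertPart_deletePart {f : ℕ → ℕ} (hf : Antitone f) (i : ℕ) :
    insertPart (f i) (deletePart i f) = f := by
  funext n
  cases n with
  | zero =>
    have h0 := hf (Nat.zero_le i)
    have h1 := hf (Nat.zero_le 1)
    rcases Nat.eq_zero_or_pos i with rfl | hi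
    · simpa [insertPart, deletePart] using h1
    · simpa [insertPart, deletePart, hi] using h0
  | succ n =>
    have h1 := hf (Nat.le_succ n)
    have h2 := hf (Nat.le_succ (n + 1))
    simp only [Nat.succ_eq_add_one] at h1 h2
    rcases lt_trichotomy (n + 1) i with h | rfl | h
    · have h3 := hf h.le
      simp only [insertPart, deletePart, h, (Nat.lt_succ_self n).trans h, if_true]
      omega
    · simp only [insertPart, deletePart, Nat.lt_succ_self, lt_irrefl, if_true, if_false]
      omega
    · have h3 := hf h.le
      simp only [insertPart, deletePart, h.not_gt, (Nat.le_of_lt_succ h).not_gt, if_false]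
      omega

theorem exists_insertPart_eq {f : ℕ → ℕ} {t : ℕ} (h : ∃ n, f n ≤ t) :
    ∃ i, insertPart t f i = t := by
  classical
  refine ⟨Nat.find h, ?_⟩
  have hle := Nat.find_spec h
  have hmin := fun m => Nat.find_min h (m := m)
  generalize Nat.find h = i at hle hmin
  cases i with
  | zero => exact max_eq_right hle
  | succ i =>
    have := hmin i (Nat.lt_succ_self i)
    simp only [insertPart]
    omega

/-- Remark 0429(2): a bipartition `[M; L]` with `‖M‖ + ‖L‖ = w + τ` is in the
image of the ε = + map `θ_k` on pairs of partitions of total size `w`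
(with `k ≤ λ_1`) if and only if `τ + k` occurs as a part of `M`. -/
theorem stmt13 (τ k w : ℕ) (M L : ℕ → ℕ)
    (hM : IsPartition M) (hL : IsPartition L)
    (hsz : psize M + psize L = w + τ) :
    (∃ lam mu : ℕ → ℕ, IsPartition lam ∧ IsPartition mu ∧
      psize lam + psize mu = w ∧ k ≤ lam 0 ∧
      insertPart (τ + k) mu = M ∧
      (insertPart (lam 0 - k) fun n => lam (n + 1)) = L) ↔
    ∃ i, M i = τ + k := by
  constructor
  · rintro ⟨lam, mu, -, ⟨-, N, hN⟩, -, -, rfl, -⟩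
    exact exists_insertPart_eq ⟨N, by simp [hN N le_rfl]⟩
  · rintro ⟨i, hi⟩
    set lam : ℕ → ℕ := fun n => if n = 0 then L 0 + k else L n with hlam
    have hlam_zero : lam 0 = L 0 + k := by simp [hlam]
    have hlam_tail : (fun n => lam (n + 1)) = fun n => L (n + 1) := by simp [hlam]
    have hlam_part : IsPartition lam := by
      obtain ⟨hanti, N, hN⟩ := hL
      refine ⟨antitone_nat_of_succ_le fun n => ?_, N + 1, fun n hn => ?_⟩
      · have := hanti (Nat.le_succ n)
        simp only [hlam]
        split_ifs <;> simp_all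
        omega
      · simp [hlam, show n ≠ 0 by omega, hN n (by omega)]
    refine ⟨lam, deletePart i M, hlam_part, hM.deletePart i, ?_, by omega, ?_, ?_⟩
    · have h1 := psize_deletePart_add hM.2 i
      have h2 := psize_eq_head_add_tail hlam_part.2
      have h3 := psize_eq_head_add_tail hL.2
      rw [hlam_tail, hlam_zero] at h2
      omega
    · rw [← hi]
      exact insertPart_deletePart hM.1 i
    · rw [hlam_tail, hlam_zero, Nat.add_sub_cancel, ← deletePart_zero]
      exact insertPart_deletePart hL.1 0
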